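/- arXiv:1607.06677 — 3 statements merged into one kernel-verified Lean document; each statement's English description precedes it below -/
import Mathlib

section
/- There exists an absolute constant C > 0 with the following property. Let n ≥ 1 be an integer, M > 1, K > 1, and let g₁, g₂ : ℝ → ℂ be n-times continuously differentiable, supported in a compact subset of (0,1), with ‖gⱼ‖_{H^n(0,1)} ≤ M. For s > 0 set I₂(s) = ∫₀^s ( |∫₀¹ e^{2iκx}(g₁−g₂)(x) dx|² + |∫₀¹ e^{−2iκx}(g₁−g₂)(x) dx|² ) dκ, and set ε₂ = I₂(K)^{1/2}. If 0 < ε₂ < 1, then there exists a function μ : (K, ∞) → ℝ with μ(s) ≥ 1/2 for s ∈ (K, 2^{1/4}K) and μ(s) ≥ (1/π)((s/K)⁴ − 1)^{−1/2} for s ∈ (2^{1/4}K, ∞), such that I₂(s) ≤ C M² e^{5s} ε₂^{2μ(s)} for all s ∈ (K, ∞). -/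
open MeasureTheory Real

theorem Complex.arg_eq_arctan_of_re_pos {z : ℂ} (hz : 0 < z.re) :
    z.arg = Real.arctan (z.im / z.re) := by
  have h := abs_lt.1 (Complex.abs_arg_lt_pi_div_two_iff.2 (Or.inl hz))
  rw [← Complex.tan_arg, Real.arctan_tan h.1 h.2]

theorem Complex.abs_im_cpow_inv_four_le_re (c : ℂ) :
    |(c ^ (1 / 4 : ℂ)).im| ≤ (c ^ (1 / 4 : ℂ)).re := by
  rcases eq_or_ne c 0 with rfl | hc
  · simp
  have him : (Complex.log c * (1 / 4)).im = c.arg / 4 := by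
    rw [show (1 / 4 : ℂ) = ((1 / 4 : ℝ) : ℂ) by norm_num, Complex.im_mul_ofReal, Complex.log_im]
    ring
  rw [Complex.cpow_def_of_ne_zero hc, Complex.exp_re, Complex.exp_im, him, abs_mul,
    abs_of_pos (Real.exp_pos _)]
  gcongr
  have h1 := Complex.neg_pi_lt_arg c
  have h2 := Complex.arg_le_pi c
  have hcos : 0 ≤ Real.cos (c.arg / 4) :=
    Real.cos_nonneg_of_neg_pi_div_two_le_of_le (by linarith) (by linarith)
  refine abs_le.2 (abs_le_of_sq_le_sq' ?_ hcos)
  have h3 : 0 ≤ Real.cos (2 * (c.arg / 4)) :=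
    Real.cos_nonneg_of_neg_pi_div_two_le_of_le (by linarith) (by linarith)
  rw [Real.cos_two_mul] at h3
  nlinarith [Real.sin_sq_add_cos_sq (c.arg / 4)]

theorem Complex.one_add_sq_mem_slitPlane {z : ℂ} (hz : 0 < z.re) :
    1 + z ^ 2 ∈ Complex.slitPlane := by
  rw [Complex.mem_slitPlane_iff]
  by_cases h : z.im = 0
  · left
    simp [pow_two, h]
    positivity
  · right
    simp [pow_two]
    have := mul_ne_zero hz.ne' h
    intro h'
    apply this
    linarith

theorem Real.arctan_le_self_of_nonneg {x : ℝ} (hx : 0 ≤ x) : Real.arctan x ≤ x := by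
  have := Real.le_tan (Real.arctan_nonneg.2 hx) (Real.arctan_lt_pi_div_two x)
  rwa [Real.tan_arctan] at this

theorem Real.half_le_arctan_four_sevenths_mul {x : ℝ} (h0 : 0 ≤ x) (h1 : x ≤ 1) :
    x / 2 ≤ Real.arctan (4 / 7 * x) := by
  have hpi := Real.pi_gt_three
  rw [← Real.arctan_tan (x := x / 2) (by linarith) (by linarith)]
  apply Real.arctan_mono
  rw [Real.tan_eq_sin_div_cos]
  have hc : 7 / 8 ≤ Real.cos (x / 2) := by
    have := Real.one_sub_sq_div_two_le_cos (x := x / 2)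
    nlinarith
  rw [div_le_iff₀ (by linarith)]
  have := Real.sin_le (x := x / 2) (by linarith)
  nlinarith

/-- The difference of arguments of `z ± i a`, which up to the factor `1 / π` is the harmonic
measure of `[-i a, i a]` in the right half-plane. -/
noncomputable def segmentAngle (a : ℝ) (z : ℂ) : ℝ :=
  (z + a * Complex.I).arg - (z - a * Complex.I).arg

theorem segmentAngle_le_pi (a : ℝ) {z : ℂ} (hz : 0 < z.re) : segmentAngle a z ≤ π := by
  have h1 := abs_lt.1 (Complex.abs_arg_lt_pi_div_two_iff (z := z + a * Complex.I).2
    (Or.inl (by simpa using hz)))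
  have h2 := abs_lt.1 (Complex.abs_arg_lt_pi_div_two_iff (z := z - a * Complex.I).2
    (Or.inl (by simpa using hz)))
  unfold segmentAngle
  linarith

theorem segmentAngle_le_of_one_lt_abs_im {a : ℝ} (ha : a < 1) {z : ℂ} (hz : 0 < z.re)
    (him : 1 < |z.im|) : segmentAngle a z ≤ z.re / (1 - a) := by
  have key : ∀ u : ℝ, 1 - a ≤ u → π / 2 - Real.arctan (u / z.re) ≤ z.re / (1 - a) := by
    intro u hu
    have hu0 : 0 < u := by linarith
    have h1 := Real.arctan_inv_of_pos (div_pos hu0 hz)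
    rw [← h1, inv_div]
    refine (Real.arctan_le_self_of_nonneg (by positivity)).trans ?_
    gcongr
  unfold segmentAngle
  rw [Complex.arg_eq_arctan_of_re_pos (by simpa using hz),
    Complex.arg_eq_arctan_of_re_pos (by simpa using hz)]
  simp only [Complex.add_im, Complex.sub_im, Complex.add_re, Complex.sub_re, Complex.mul_I_im,
    Complex.mul_I_re, Complex.ofReal_re, Complex.ofReal_im, neg_zero, add_zero, sub_zero]
  rcases lt_abs.1 him with h | h
  · have := key (z.im - a) (by linarith)
    linarith [Real.arctan_lt_pi_div_two ((z.im + a) / z.re)]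
  · have := key (-(z.im + a)) (by linarith)
    rw [neg_div, Real.arctan_neg] at this
    linarith [Real.neg_pi_div_two_lt_arctan ((z.im - a) / z.re)]

theorem segmentAngle_ofReal (a : ℝ) {t : ℝ} (ht : 0 < t) :
    segmentAngle a t = 2 * Real.arctan (a / t) := by
  unfold segmentAngle
  rw [Complex.arg_eq_arctan_of_re_pos (by simpa using ht),
    Complex.arg_eq_arctan_of_re_pos (by simpa using ht)]
  simp [neg_div, Real.arctan_neg]
  ring

theorem exists_holomorphic_norm_eq_exp_segmentAngle (a b : ℝ) :
    ∃ E : ℂ → ℂ, DifferentiableOn ℂ E {z | 0 < z.re} ∧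
      ∀ z, ‖E z‖ = Real.exp (b * segmentAngle a z) := by
  refine ⟨fun z => Complex.exp (-(b * Complex.I) *
    (Complex.log (z + a * Complex.I) - Complex.log (z - a * Complex.I))), ?_, fun z => ?_⟩
  · intro z hz
    have hz' : 0 < z.re := hz
    refine DifferentiableAt.differentiableWithinAt ?_
    refine DifferentiableAt.cexp (DifferentiableAt.const_mul (DifferentiableAt.sub ?_ ?_) _)
    · exact DifferentiableAt.clog (by fun_prop) (Or.inl (by simpa using hz'))
    · exact DifferentiableAt.clog (by fun_prop) (Or.inl (by simpa using hz'))
  · rw [Complex.norm_exp]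
    congr 1
    simp [segmentAngle, Complex.log_im]

theorem differentiableAt_rescaled_fourth_root (K : ℝ) {z : ℂ} (hz : 0 < z.re) :
    DifferentiableAt ℂ (fun z : ℂ => (K : ℂ) * (1 + z ^ 2) ^ (1 / 4 : ℂ)) z := by
  refine DifferentiableAt.const_mul (DifferentiableAt.cpow (by fun_prop) (by fun_prop) ?_) _
  exact Complex.one_add_sq_mem_slitPlane hz

/-- Two-constants theorem on the sector `|arg z| ≤ π / 4` slit along `[0, K]`. -/
theorem norm_le_exp_neg_arctan_of_sector {h : ℂ → ℂ} {K L a t : ℝ} (hK : 0 < K)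
    (hd : Differentiable ℂ h) (hb : ∀ z : ℂ, |z.im| ≤ z.re → ‖h z‖ ≤ 1) (hL : 0 ≤ L)
    (hreal : ∀ x : ℝ, 0 ≤ x → x ≤ K → ‖h x‖ ≤ Real.exp (-L)) (ha : a < 1)
    (ht : 0 < t) :
    ‖h (K * (1 + (t : ℂ) ^ 2) ^ (1 / 4 : ℂ))‖ ≤ Real.exp (-(L * (2 / π * Real.arctan (a / t)))) := by
  have hpi := Real.pi_pos
  have hG : ∀ c : ℂ, ‖h (K * c ^ (1 / 4 : ℂ))‖ ≤ 1 := by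
    intro c
    apply hb
    rw [Complex.re_ofReal_mul, Complex.im_ofReal_mul, abs_mul, abs_of_pos hK]
    gcongr
    exact Complex.abs_im_cpow_inv_four_le_re c
  suffices H : ∀ η > 0, ‖h (K * (1 + (t : ℂ) ^ 2) ^ (1 / 4 : ℂ))‖ *
      Real.exp (L / π * (2 * Real.arctan (a / t))) ≤ Real.exp η by
    have h1 : ‖h (K * (1 + (t : ℂ) ^ 2) ^ (1 / 4 : ℂ))‖ *
      Real.exp (L / π * (2 * Real.arctan (a / t))) ≤ 1 := by
      have hlim : Filter.Tendsto Real.exp (nhdsWithin 0 (Set.Ioi 0)) (nhds 1) := by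
        rw [← Real.exp_zero]
        exact Real.continuous_exp.continuousAt.tendsto.mono_left nhdsWithin_le_nhds
      refine ge_of_tendsto hlim ?_
      filter_upwards [self_mem_nhdsWithin] with η hη using H η hη
    rw [Real.exp_neg, ← one_div, le_div_iff₀ (Real.exp_pos _)]
    rwa [show L * (2 / π * Real.arctan (a / t)) = L / π * (2 * Real.arctan (a / t)) by ring]
  intro η hη
  obtain ⟨ρ, hρ, hρG⟩ : ∃ ρ > 0, ∀ c : ℂ, ∀ x : ℝ, 0 ≤ x → x ≤ 1 → dist c x < ρ →
      ‖h (K * c ^ (1 / 4 : ℂ))‖ ≤ Real.exp (-L + η) := by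
    have hcomp : IsCompact ((fun x : ℝ => (x : ℂ)) '' Set.Icc 0 1) :=
      isCompact_Icc.image Complex.continuous_ofReal
    have hU : {c : ℂ | ‖h (K * c ^ (1 / 4 : ℂ))‖ < Real.exp (-L + η)} ∈
        nhdsSet ((fun x : ℝ => (x : ℂ)) '' Set.Icc 0 1) := by
      rw [mem_nhdsSet_iff_forall]
      rintro _ ⟨x, ⟨hx0, hx1⟩, rfl⟩
      have hc : ContinuousAt (fun c : ℂ => ‖h (K * c ^ (1 / 4 : ℂ))‖) x := by
        refine ContinuousAt.norm (ContinuousAt.comp (f := fun c : ℂ => K * c ^ (1 / 4 : ℂ))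
          hd.continuous.continuousAt (ContinuousAt.mul continuousAt_const ?_))
        exact Complex.continuousAt_cpow_const_of_re_pos (Or.inl (by simpa using hx0)) (by norm_num)
      refine hc.eventually_lt_const ?_
      have : ((K : ℂ) * (x : ℂ) ^ (1 / 4 : ℂ)) = ((K * x ^ (1 / 4 : ℝ) : ℝ) : ℂ) := by
        rw [Complex.ofReal_mul, Complex.ofReal_cpow hx0]
        norm_num
      change ‖h (K * (x : ℂ) ^ (1 / 4 : ℂ))‖ < _
      rw [this]
      refine (hreal _ (by positivity) ?_).trans_lt (Real.exp_lt_exp.2 (by linarith))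
      exact mul_le_of_le_one_right hK.le (Real.rpow_le_one hx0 hx1 (by norm_num))
    obtain ⟨V, hV, hsV, hVU⟩ := mem_nhdsSet_iff_exists.1 hU
    obtain ⟨ρ, hρ, hth⟩ := hcomp.exists_thickening_subset_open hV hsV
    refine ⟨ρ, hρ, fun c x h0 h1 hx => le_of_lt (hVU (hth ?_))⟩
    rw [Metric.mem_thickening_iff]
    exact ⟨x, ⟨x, ⟨h0, h1⟩, rfl⟩, hx⟩
  obtain ⟨δ, hδ0, hδt, hδρ, hδη⟩ : ∃ δ : ℝ, 0 < δ ∧ δ < t ∧ δ * δ + 2 * δ < ρ ∧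
      L / π * (δ / (1 - a)) ≤ η := by
    have hev : ∀ᶠ δ : ℝ in nhdsWithin 0 (Set.Ioi 0), δ < t ∧ δ * δ + 2 * δ < ρ ∧
        L / π * (δ / (1 - a)) < η := by
      refine nhdsWithin_le_nhds (Filter.Eventually.and ?_ (Filter.Eventually.and ?_ ?_))
      · exact eventually_lt_nhds ht
      · exact (show ContinuousAt (fun δ : ℝ => δ * δ + 2 * δ) 0 by fun_prop).eventually_lt_const
          (by simpa using hρ)
      · exact (show ContinuousAt (fun δ : ℝ => L / π * (δ / (1 - a))) 0 by fun_prop).eventually_lt_const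
          (by simpa using hη)
    obtain ⟨δ, h1, h2⟩ := (hev.and self_mem_nhdsWithin).exists
    exact ⟨δ, h2, h1.1, h1.2.1, h1.2.2.le⟩
  obtain ⟨E, hE, hEn⟩ := exists_holomorphic_norm_eq_exp_segmentAngle a (L / π)
  have hLpi : 0 ≤ L / π := by positivity
  have hbd : ∀ z : ℂ, 0 ≤ z.re →
      ‖h (K * (1 + (z + δ) ^ 2) ^ (1 / 4 : ℂ)) * E (z + δ)‖ ≤ Real.exp L := by
    intro z hz
    rw [norm_mul, hEn]
    refine (mul_le_of_le_one_left (Real.exp_pos _).le (hG _)).trans (Real.exp_le_exp.2 ?_)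
    have := segmentAngle_le_pi a (z := z + δ) (by simp; linarith)
    calc L / π * segmentAngle a (z + δ) ≤ L / π * π := by gcongr
      _ = L := by field_simp
  have hPL := PhragmenLindelof.right_half_plane_of_bounded_on_real
    (f := fun z : ℂ => h (K * (1 + (z + δ) ^ 2) ^ (1 / 4 : ℂ)) * E (z + δ)) (C := Real.exp η)
    (z := ((t - δ : ℝ) : ℂ)) ?_ ?_ ?_ ?_ ?_
  · have hz : (((t - δ : ℝ) : ℂ) + δ) = t := by push_cast; ring
    simpa only [hz, norm_mul, hEn, segmentAngle_ofReal a ht] using hPL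
  · refine DifferentiableOn.diffContOnCl ?_
    rw [Complex.closure_setOfPred_lt_re]
    intro z hz
    have hz' : 0 < (z + δ).re := by
      have : 0 ≤ z.re := hz
      simp; linarith
    have hopen : IsOpen {z : ℂ | 0 < z.re} := isOpen_lt continuous_const Complex.continuous_re
    refine DifferentiableAt.differentiableWithinAt (DifferentiableAt.mul ?_ ?_)
    · exact DifferentiableAt.comp z (hd _) (DifferentiableAt.comp z (f := fun z : ℂ => z + δ)
        (differentiableAt_rescaled_fourth_root K hz') (by fun_prop))
    · exact DifferentiableAt.comp z (f := fun z : ℂ => z + δ)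
        (hE.differentiableAt (hopen.mem_nhds hz')) (by fun_prop)
  · refine ⟨1, by norm_num, 0, Asymptotics.IsBigO.of_bound (Real.exp L) ?_⟩
    refine Filter.Eventually.filter_mono inf_le_right (Filter.eventually_principal.2 ?_)
    intro z hz
    simpa using hbd z (le_of_lt hz)
  · refine ⟨Real.exp L, Filter.eventually_map.2 ?_⟩
    filter_upwards [Filter.eventually_ge_atTop 0] with x hx
    exact hbd x (by simpa using hx)
  · intro y
    have hre : ((y : ℂ) * Complex.I + δ).re = δ := by simp
    have him : ((y : ℂ) * Complex.I + δ).im = y := by simp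
    rw [norm_mul, hEn]
    rcases le_or_gt |y| 1 with hy | hy
    · have h1 := hρG (1 + ((y : ℂ) * Complex.I + δ) ^ 2) (1 - y ^ 2)
        (by nlinarith [abs_le.1 hy]) (by nlinarith) ?_
      · have h2 := segmentAngle_le_pi a (z := (y : ℂ) * Complex.I + δ) (by rw [hre]; exact hδ0)
        calc _ ≤ Real.exp (-L + η) * Real.exp (L / π * π) := by gcongr
          _ = Real.exp η := by
            rw [← Real.exp_add]
            congr 1
            field_simp
            ring
      · rw [dist_eq_norm]
        have : (1 + ((y : ℂ) * Complex.I + δ) ^ 2) - ((1 - y ^ 2 : ℝ) : ℂ) =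
            ((δ * δ : ℝ) : ℂ) + ((2 * δ * y : ℝ) : ℂ) * Complex.I := by
          push_cast
          linear_combination (y : ℂ) ^ 2 * Complex.I_sq
        rw [this]
        refine (norm_add_le _ _).trans_lt ?_
        rw [norm_mul, Complex.norm_I, Complex.norm_real, Complex.norm_real, mul_one,
          Real.norm_eq_abs, Real.norm_eq_abs, abs_mul (2 * δ), abs_of_pos (by positivity : 0 < δ * δ),
          abs_of_pos (by positivity : 0 < 2 * δ)]
        nlinarith
    · refine (mul_le_of_le_one_left (Real.exp_pos _).le (hG _)).trans (Real.exp_le_exp.2 ?_)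
      have h2 := segmentAngle_le_of_one_lt_abs_im ha (z := (y : ℂ) * Complex.I + δ)
        (by rw [hre]; exact hδ0) (by rwa [him])
      rw [hre] at h2
      exact (mul_le_mul_of_nonneg_left h2 hLpi).trans hδη
  · simp; linarith

/-- The Fourier–Laplace transform of a function on the unit interval. -/
noncomputable def unitLaplace (c : ℂ) (g : ℝ → ℂ) (z : ℂ) : ℂ :=
  ∫ x in (0 : ℝ)..1, Complex.exp (c * z * x) * g x

theorem differentiable_unitLaplace (c : ℂ) {g : ℝ → ℂ} (hg : Continuous g) :
    Differentiable ℂ (unitLaplace c g) := by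
  intro z₀
  let B : ℝ → ℝ := fun x => Real.exp (‖c‖ * (‖z₀‖ + 1)) * ‖c‖ * ‖g x‖
  have h := intervalIntegral.hasDerivAt_integral_of_dominated_loc_of_deriv_le
    (μ := volume) (a := 0) (b := 1) (x₀ := z₀) (bound := B)
    (F := fun z (x : ℝ) => Complex.exp (c * z * x) * g x)
    (F' := fun z (x : ℝ) => Complex.exp (c * z * x) * (c * x) * g x)
    (Metric.ball_mem_nhds z₀ one_pos)
    (Filter.Eventually.of_forall fun z => Continuous.aestronglyMeasurable (by fun_prop))
    (Continuous.intervalIntegrable (by fun_prop) _ _)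
    (Continuous.aestronglyMeasurable (by fun_prop)) ?_
    (Continuous.intervalIntegrable (by fun_prop) _ _) ?_
  · exact h.2.differentiableAt
  · refine Filter.Eventually.of_forall fun x hx z hz => ?_
    rw [Set.uIoc_of_le zero_le_one] at hx
    have hzn : ‖z‖ ≤ ‖z₀‖ + 1 := by
      have h1 : ‖z - z₀‖ < 1 := by simpa [dist_eq_norm] using hz
      linarith [norm_le_norm_add_norm_sub' z z₀]
    have hxn : ‖(x : ℂ)‖ ≤ 1 := by
      rw [Complex.norm_real, Real.norm_eq_abs, abs_of_pos hx.1]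
      exact hx.2
    simp only [norm_mul, B]
    gcongr
    · refine (Complex.norm_exp_le_exp_norm _).trans (Real.exp_le_exp.2 ?_)
      rw [norm_mul, norm_mul]
      calc ‖c‖ * ‖z‖ * ‖(x : ℂ)‖ ≤ ‖c‖ * ‖z‖ * 1 := by gcongr
        _ ≤ ‖c‖ * (‖z₀‖ + 1) := by rw [mul_one]; gcongr
    · exact mul_le_of_le_one_right (norm_nonneg _) hxn
  · refine Filter.Eventually.of_forall fun x _ z _ => ?_
    have h1 : HasDerivAt (fun z : ℂ => c * z * x) (c * x) z := by
      simpa using ((hasDerivAt_id z).const_mul c).mul_const (x : ℂ)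
    exact h1.cexp.mul_const _

theorem norm_unitLaplace_le {c : ℂ} {g : ℝ → ℂ} (hg : Continuous g) {z : ℂ} {A : ℝ}
    (hA : 0 ≤ A) (hc : (c * z).re ≤ A) :
    ‖unitLaplace c g z‖ ≤ Real.exp A * ∫ x in (0 : ℝ)..1, ‖g x‖ := by
  rw [← intervalIntegral.integral_const_mul]
  refine intervalIntegral.norm_integral_le_of_norm_le zero_le_one ?_
    (Continuous.intervalIntegrable (by fun_prop) _ _)
  refine Filter.Eventually.of_forall fun x hx => ?_
  rw [norm_mul, Complex.norm_exp, Complex.re_mul_ofReal]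
  gcongr
  nlinarith [hx.1, hx.2]

theorem integral_norm_le_of_integral_norm_sq_le {g : ℝ → ℂ} (hg : Continuous g) {M : ℝ}
    (hM : 0 < M) (h : ∫ x in (0 : ℝ)..1, ‖g x‖ ^ 2 ≤ M ^ 2) : ∫ x in (0 : ℝ)..1, ‖g x‖ ≤ M := by
  have h1 : ∫ x in (0 : ℝ)..1, ‖g x‖ ≤ ∫ x in (0 : ℝ)..1, (1 / (2 * M) * ‖g x‖ ^ 2 + M / 2) := by
    refine intervalIntegral.integral_mono_on zero_le_one
      (Continuous.intervalIntegrable (by fun_prop) _ _)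
      (Continuous.intervalIntegrable (by fun_prop) _ _) fun x _ => ?_
    have : 1 / (2 * M) * ‖g x‖ ^ 2 + M / 2 - ‖g x‖ = (‖g x‖ - M) ^ 2 / (2 * M) := by
      field_simp
      ring
    have : 0 ≤ (‖g x‖ - M) ^ 2 / (2 * M) := by positivity
    linarith
  rw [intervalIntegral.integral_add (Continuous.intervalIntegrable (by fun_prop) _ _)
    (Continuous.intervalIntegrable (by fun_prop) _ _), intervalIntegral.integral_const_mul] at h1
  have h2 : 1 / (2 * M) * ∫ x in (0 : ℝ)..1, ‖g x‖ ^ 2 ≤ 1 / (2 * M) * M ^ 2 := by gcongr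
  have h3 : 1 / (2 * M) * M ^ 2 = M / 2 := by field_simp
  simp only [intervalIntegral.integral_const, sub_zero, one_smul] at h1
  linarith

theorem integral_norm_le_of_sobolev_le {g : ℝ → ℂ} (hg : Continuous g) {M : ℝ} (hM : 0 < M) (n : ℕ)
    (h : Real.sqrt (∑ k ∈ Finset.range (n + 1),
      ∫ x in (0 : ℝ)..1, ‖iteratedDeriv k g x‖ ^ 2) ≤ M) : ∫ x in (0 : ℝ)..1, ‖g x‖ ≤ M := by
  refine integral_norm_le_of_integral_norm_sq_le hg hM ?_
  have h1 := (Real.sqrt_le_left hM.le).1 h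
  refine le_trans ?_ h1
  have h2 := Finset.single_le_sum (f := fun k => ∫ x in (0 : ℝ)..1, ‖iteratedDeriv k g x‖ ^ 2)
    (s := Finset.range (n + 1)) (fun k _ => intervalIntegral.integral_nonneg zero_le_one
      fun x _ => by positivity) (Finset.mem_range.2 n.succ_pos)
  simpa using h2

theorem ofReal_norm_sq_unitLaplace (c : ℂ) (g : ℝ → ℂ) (κ : ℝ) :
    ((‖unitLaplace c g κ‖ ^ 2 : ℝ) : ℂ) = unitLaplace c g κ *
      unitLaplace (starRingEnd ℂ c) (fun x => starRingEnd ℂ (g x)) κ := by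
  have h : unitLaplace (starRingEnd ℂ c) (fun x => starRingEnd ℂ (g x)) κ =
      starRingEnd ℂ (unitLaplace c g κ) := by
    unfold unitLaplace
    rw [← intervalIntegral.intervalIntegral_conj]
    congr 1
    ext x
    simp [← Complex.exp_conj]
  rw [h, Complex.mul_conj']
  norm_cast

/-- The energy of the Fourier data in the frequency band `[0, s]` extends to an entire function
of `s` which grows at most exponentially in the sector `|arg s| ≤ π / 4`. -/
theorem exists_entire_extension_of_energy {g : ℝ → ℂ} (hg : Continuous g) {M : ℝ}
    (hM : ∫ x in (0 : ℝ)..1, ‖g x‖ ≤ 2 * M) {J : ℝ → ℝ}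
    (hJ : ∀ s : ℝ, J s = ∫ κ in (0 : ℝ)..s, (‖unitLaplace (2 * Complex.I) g κ‖ ^ 2 +
      ‖unitLaplace (-(2 * Complex.I)) g κ‖ ^ 2)) :
    ∃ Φ : ℂ → ℂ, Differentiable ℂ Φ ∧ (∀ s : ℝ, Φ s = J s) ∧
      ∀ z : ℂ, |z.im| ≤ z.re → ‖Φ z‖ ≤ 16 * M ^ 2 * Real.exp (5 * z.re) := by
  let g' : ℝ → ℂ := fun x => starRingEnd ℂ (g x)
  have hg' : Continuous g' := Complex.continuous_conj.comp hg
  have hint : ∫ x in (0 : ℝ)..1, ‖g' x‖ ≤ 2 * M := by simpa [g'] using hM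
  have hM0 : 0 ≤ 2 * M := le_trans
    (intervalIntegral.integral_nonneg zero_le_one fun x _ => norm_nonneg _) hM
  let c : ℂ := 2 * Complex.I
  let P : ℂ → ℂ := fun z => unitLaplace c g z * unitLaplace (-c) g' z +
    unitLaplace (-c) g z * unitLaplace c g' z
  have hP : Differentiable ℂ P :=
    ((differentiable_unitLaplace _ hg).mul (differentiable_unitLaplace _ hg')).add
      ((differentiable_unitLaplace _ hg).mul (differentiable_unitLaplace _ hg'))
  obtain ⟨Φ, hΦ0, hΦ⟩ := hP.isExactOn_univ.with_val_at 0 0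
  have hΦ' : ∀ z, HasDerivAt Φ (P z) z := fun z => hΦ z (Set.mem_univ _)
  refine ⟨Φ, fun z => (hΦ' z).differentiableAt, fun s => ?_, fun z hz => ?_⟩
  · rw [hJ, ← intervalIntegral.integral_ofReal]
    have hPr : ∀ κ : ℝ, ((‖unitLaplace (2 * Complex.I) g κ‖ ^ 2 +
        ‖unitLaplace (-(2 * Complex.I)) g κ‖ ^ 2 : ℝ) : ℂ) = P κ := by
      intro κ
      rw [Complex.ofReal_add, ofReal_norm_sq_unitLaplace, ofReal_norm_sq_unitLaplace]
      have h2 : starRingEnd ℂ 2 = 2 := Complex.conj_ofNat 2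
      simp [P, c, g', h2]
    simp only [hPr]
    rw [intervalIntegral.integral_eq_sub_of_hasDerivAt (f := fun κ : ℝ => Φ κ)
      (fun κ _ => (hΦ' κ).comp_ofReal)
      (Continuous.intervalIntegrable (hP.continuous.comp Complex.continuous_ofReal) _ _)]
    simp [hΦ0]
  · have hz0 : 0 ≤ z.re := (abs_nonneg _).trans hz
    have hbd : ∀ w ∈ segment ℝ 0 z, ‖P w‖ ≤ 8 * M ^ 2 * Real.exp (4 * z.re) := by
      intro w hw
      have him : |w.im| ≤ z.re := by
        rw [segment_eq_image] at hw
        obtain ⟨θ, ⟨h0, h1⟩, rfl⟩ := hw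
        simp only [smul_zero, zero_add, Complex.smul_im, smul_eq_mul, abs_mul, abs_of_nonneg h0]
        nlinarith [abs_nonneg z.im]
      have hre1 : (c * w).re ≤ 2 * z.re := by
        simp [c]
        linarith [(abs_le.1 him).1]
      have hre2 : (-c * w).re ≤ 2 * z.re := by
        simp [c]
        linarith [(abs_le.1 him).2]
      have hA : 0 ≤ 2 * z.re := by linarith
      have key : ∀ d : ℂ, (d * w).re ≤ 2 * z.re → ∀ f : ℝ → ℂ, Continuous f →
          ∫ x in (0 : ℝ)..1, ‖f x‖ ≤ 2 * M → ‖unitLaplace d f w‖ ≤ Real.exp (2 * z.re) * (2 * M) := by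
        intro d hd f hf hfM
        refine (norm_unitLaplace_le hf hA hd).trans ?_
        gcongr
      calc ‖P w‖ ≤ ‖unitLaplace c g w‖ * ‖unitLaplace (-c) g' w‖ +
            ‖unitLaplace (-c) g w‖ * ‖unitLaplace c g' w‖ := by
            rw [← norm_mul, ← norm_mul]
            exact norm_add_le _ _
        _ ≤ Real.exp (2 * z.re) * (2 * M) * (Real.exp (2 * z.re) * (2 * M)) +
            Real.exp (2 * z.re) * (2 * M) * (Real.exp (2 * z.re) * (2 * M)) := by
            gcongr
            · exact key _ hre1 _ hg hM
            · exact key _ hre2 _ hg' hint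
            · exact key _ hre2 _ hg hM
            · exact key _ hre1 _ hg' hint
        _ = 8 * M ^ 2 * Real.exp (4 * z.re) := by
            rw [show 4 * z.re = 2 * z.re + 2 * z.re by ring, Real.exp_add]
            ring
    have h1 := Convex.norm_image_sub_le_of_norm_hasDerivWithin_le
      (fun w _ => (hΦ' w).hasDerivWithinAt) hbd (convex_segment 0 z)
      (left_mem_segment ℝ 0 z) (right_mem_segment ℝ 0 z)
    rw [hΦ0, sub_zero, sub_zero] at h1
    have hn : ‖z‖ ≤ 2 * z.re := by
      have := Complex.norm_le_abs_re_add_abs_im z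
      rw [abs_of_nonneg hz0] at this
      linarith
    have he : z.re ≤ Real.exp z.re := by linarith [Real.add_one_le_exp z.re]
    calc ‖Φ z‖ ≤ 8 * M ^ 2 * Real.exp (4 * z.re) * ‖z‖ := h1
      _ ≤ 8 * M ^ 2 * Real.exp (4 * z.re) * (2 * Real.exp z.re) := by
        gcongr
        linarith
      _ = 16 * M ^ 2 * Real.exp (5 * z.re) := by
        rw [show 5 * z.re = 4 * z.re + z.re by ring, Real.exp_add]
        ring

/-- Lemma 3.6 of the paper (second estimate): decay of the analytically continued
data integral `I₂` beyond the frequency band `(0, K]`. -/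
theorem continued_data_bound_I2 :
    ∃ C > (0:ℝ), ∀ (n : ℕ), 1 ≤ n → ∀ (M K : ℝ), 1 < M → 1 < K →
    ∀ (g₁ g₂ : ℝ → ℂ), ContDiff ℝ n g₁ → ContDiff ℝ n g₂ →
    tsupport g₁ ⊆ Set.Ioo 0 1 → tsupport g₂ ⊆ Set.Ioo 0 1 →
    Real.sqrt (∑ k ∈ Finset.range (n+1),
      ∫ x in (0:ℝ)..1, ‖iteratedDeriv k g₁ x‖^2) ≤ M →
    Real.sqrt (∑ k ∈ Finset.range (n+1),
      ∫ x in (0:ℝ)..1, ‖iteratedDeriv k g₂ x‖^2) ≤ M →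
    ∀ I₂ : ℝ → ℝ,
      (∀ s : ℝ, I₂ s = ∫ κ in (0:ℝ)..s,
        (‖∫ x in (0:ℝ)..1, Complex.exp (2 * Complex.I * κ * x) * (g₁ x - g₂ x)‖^2 +
         ‖∫ x in (0:ℝ)..1, Complex.exp (-(2 * Complex.I * κ * x)) * (g₁ x - g₂ x)‖^2)) →
    ∀ ε₂ : ℝ, ε₂ = Real.sqrt (I₂ K) → 0 < ε₂ → ε₂ < 1 →
    ∃ μ : ℝ → ℝ,
      (∀ s ∈ Set.Ioo K ((2:ℝ)^((1:ℝ)/4) * K), μ s ≥ 1/2) ∧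
      (∀ s ∈ Set.Ioi ((2:ℝ)^((1:ℝ)/4) * K), μ s ≥ (1/π) * ((s/K)^4 - 1)^(-(1:ℝ)/2)) ∧
      (∀ s ∈ Set.Ioi K, I₂ s ≤ C * M^2 * Real.exp (5*s) * ε₂^(2 * μ s)) := by
  refine ⟨16, by norm_num, ?_⟩
  intro n hn M K hM hK g₁ g₂ hg₁ hg₂ _ _ hs₁ hs₂ J hJ ε hε hε0 hε1
  have hM0 : 0 < M := by linarith
  have hK0 : 0 < K := by linarith
  have hc₁ := hg₁.continuous
  have hc₂ := hg₂.continuous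
  have hg : Continuous fun x => g₁ x - g₂ x := hc₁.sub hc₂
  have hgM : ∫ x in (0:ℝ)..1, ‖g₁ x - g₂ x‖ ≤ 2 * M := by
    have h₁ := integral_norm_le_of_sobolev_le hc₁ hM0 n hs₁
    have h₂ := integral_norm_le_of_sobolev_le hc₂ hM0 n hs₂
    have h : ∫ x in (0:ℝ)..1, ‖g₁ x - g₂ x‖ ≤ ∫ x in (0:ℝ)..1, (‖g₁ x‖ + ‖g₂ x‖) :=
      intervalIntegral.integral_mono_on zero_le_one
        (Continuous.intervalIntegrable (by fun_prop) _ _)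
        (Continuous.intervalIntegrable (by fun_prop) _ _) fun x _ => norm_sub_le _ _
    rw [intervalIntegral.integral_add (Continuous.intervalIntegrable (by fun_prop) _ _)
      (Continuous.intervalIntegrable (by fun_prop) _ _)] at h
    linarith
  have hJ' : ∀ s : ℝ, J s = ∫ κ in (0 : ℝ)..s,
      (‖unitLaplace (2 * Complex.I) (fun x => g₁ x - g₂ x) κ‖ ^ 2 +
        ‖unitLaplace (-(2 * Complex.I)) (fun x => g₁ x - g₂ x) κ‖ ^ 2) := by
    intro s
    rw [hJ]
    simp only [unitLaplace, neg_mul]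
  obtain ⟨Φ, hΦd, hΦJ, hΦb⟩ := exists_entire_extension_of_energy hg hgM hJ'
  have hJint : ∀ a b : ℝ, IntervalIntegrable (fun κ : ℝ =>
      ‖unitLaplace (2 * Complex.I) (fun x => g₁ x - g₂ x) κ‖ ^ 2 +
        ‖unitLaplace (-(2 * Complex.I)) (fun x => g₁ x - g₂ x) κ‖ ^ 2) volume a b := by
    intro a b
    have h₁ := (differentiable_unitLaplace (2 * Complex.I) hg).continuous
    have h₂ := (differentiable_unitLaplace (-(2 * Complex.I)) hg).continuous
    exact Continuous.intervalIntegrable (by fun_prop) _ _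
  have hJ0 : ∀ s, 0 ≤ s → 0 ≤ J s := by
    intro s hs
    rw [hJ']
    exact intervalIntegral.integral_nonneg hs fun κ _ => by positivity
  have hJmono : ∀ s, 0 ≤ s → s ≤ K → J s ≤ J K := by
    intro s hs hsK
    rw [hJ' s, hJ' K]
    exact intervalIntegral.integral_mono_interval le_rfl hs hsK
      (Filter.Eventually.of_forall fun κ => by positivity) (hJint 0 K)
  have hJK : J K = ε ^ 2 := by
    rw [hε, Real.sq_sqrt (hJ0 K hK0.le)]
  have hlog : Real.log ε < 0 := Real.log_neg hε0 hε1
  have hexpL : Real.exp (-(-(2 * Real.log ε))) = ε ^ 2 := by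
    rw [neg_neg, two_mul, Real.exp_add, Real.exp_log hε0]
    ring
  have hpos : (0 : ℝ) < 16 * M ^ 2 := by positivity
  let h : ℂ → ℂ := fun z => Φ z * Complex.exp (-(5 * z)) / ((16 * M ^ 2 : ℝ) : ℂ)
  have hhd : Differentiable ℂ h :=
    (hΦd.mul (Differentiable.cexp (by fun_prop))).div_const _
  have hhn : ∀ z, ‖h z‖ = ‖Φ z‖ / (16 * M ^ 2 * Real.exp (5 * z.re)) := by
    intro z
    simp only [h]
    rw [norm_div, norm_mul, Complex.norm_exp, Complex.norm_real, Real.norm_eq_abs, abs_of_pos hpos]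
    rw [show (-(5 * z)).re = -(5 * z.re) by simp, Real.exp_neg]
    field_simp
  have hhb : ∀ z : ℂ, |z.im| ≤ z.re → ‖h z‖ ≤ 1 := by
    intro z hz
    rw [hhn, div_le_one (by positivity)]
    exact hΦb z hz
  have hhreal : ∀ x : ℝ, 0 ≤ x → x ≤ K → ‖h x‖ ≤ Real.exp (-(-(2 * Real.log ε))) := by
    intro x hx hxK
    rw [hhn, hΦJ, hexpL, Complex.norm_real, Real.norm_eq_abs, abs_of_nonneg (hJ0 x hx),
      Complex.ofReal_re]
    have h₁ : 1 ≤ 16 * M ^ 2 * Real.exp (5 * x) := by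
      have := Real.one_le_exp (x := 5 * x) (by positivity)
      nlinarith
    exact (div_le_self (hJ0 x hx) h₁).trans (hJK ▸ hJmono x hx hxK)
  have key : ∀ s, K < s → ∀ a < 1, ∀ ν : ℝ,
      ν ≤ 2 / π * Real.arctan (a / Real.sqrt ((s / K) ^ 4 - 1)) →
      J s ≤ 16 * M ^ 2 * Real.exp (5 * s) * ε ^ (2 * ν) := by
    intro s hs a ha ν hν
    have hs0 : 0 < s := by linarith
    have hsK : 1 < s / K := (one_lt_div hK0).2 hs
    have ht : 0 < (s / K) ^ 4 - 1 := sub_pos.2 (one_lt_pow₀ hsK (by norm_num))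
    have hmain := norm_le_exp_neg_arctan_of_sector (L := -(2 * Real.log ε)) hK0 hhd hhb
      (by linarith) hhreal ha (Real.sqrt_pos.2 ht)
    have hpt : (K : ℂ) * (1 + (Real.sqrt ((s / K) ^ 4 - 1) : ℂ) ^ 2) ^ (1 / 4 : ℂ) = s := by
      rw [← Complex.ofReal_pow, Real.sq_sqrt ht.le]
      have h₁ : (1 + (((s / K) ^ 4 - 1 : ℝ) : ℂ)) = (((s / K) ^ 4 : ℝ) : ℂ) := by
        push_cast
        ring
      have h₂ : ((s / K) ^ 4) ^ (1 / 4 : ℝ) = s / K := by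
        rw [← Real.rpow_natCast, ← Real.rpow_mul (by positivity)]
        norm_num
      rw [h₁, show (1 / 4 : ℂ) = ((1 / 4 : ℝ) : ℂ) by norm_num,
        ← Complex.ofReal_cpow (by positivity), h₂, ← Complex.ofReal_mul]
      congr 1
      field_simp
    rw [hpt, hhn, hΦJ, Complex.norm_real, Real.norm_eq_abs, abs_of_nonneg (hJ0 s hs0.le),
      Complex.ofReal_re, div_le_iff₀ (by positivity)] at hmain
    rw [Real.rpow_def_of_pos hε0]
    refine hmain.trans ?_
    rw [mul_comm]
    gcongr
    nlinarith
  have h2K : ∀ s, K < s → (s < (2:ℝ) ^ ((1:ℝ) / 4) * K ↔ (s / K) ^ 4 < 2) := by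
    intro s hs
    have hs0 : 0 < s := by linarith
    have h₁ : ((2:ℝ) ^ ((1:ℝ) / 4)) ^ 4 = 2 := by
      rw [← Real.rpow_natCast, ← Real.rpow_mul (by norm_num)]
      norm_num
    rw [← div_lt_iff₀ hK0, ← pow_lt_pow_iff_left₀ (by positivity) (by positivity) four_ne_zero, h₁]
  refine ⟨fun s => if s < (2:ℝ) ^ ((1:ℝ) / 4) * K then 1 / 2 else
    if s = (2:ℝ) ^ ((1:ℝ) / 4) * K then 0 else (1 / π) * ((s / K) ^ 4 - 1) ^ (-(1:ℝ) / 2),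
    fun s hs => ?_, fun s hs => ?_, fun s hs => ?_⟩
  · dsimp only
    rw [if_pos hs.2]
  · have hs' : (2:ℝ) ^ ((1:ℝ) / 4) * K < s := hs
    dsimp only
    rw [if_neg hs'.not_gt, if_neg hs'.ne']
  · have hs' : K < s := hs
    have hsK : 1 < s / K := (one_lt_div hK0).2 hs'
    have ht : 0 < (s / K) ^ 4 - 1 := sub_pos.2 (one_lt_pow₀ hsK (by norm_num))
    have hpi := Real.pi_pos
    dsimp only
    split_ifs with h₁ h₂
    · rw [h2K s hs'] at h₁
      refine key s hs' (Real.sqrt ((s / K) ^ 4 - 1)) ?_ _ ?_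
      · rw [Real.sqrt_lt' one_pos]
        linarith
      · rw [div_self (Real.sqrt_pos.2 ht).ne', Real.arctan_one]
        field_simp
        norm_num
    · exact key s hs' 0 one_pos 0 (by simp)
    · rw [h2K s hs', not_lt] at h₁
      refine key s hs' (4 / 7) (by norm_num) _ ?_
      have h₃ : ((s / K) ^ 4 - 1) ^ (-(1:ℝ) / 2) = 1 / Real.sqrt ((s / K) ^ 4 - 1) := by
        rw [neg_div, Real.rpow_neg ht.le, ← Real.sqrt_eq_rpow, one_div]
      have h₄ : 1 / Real.sqrt ((s / K) ^ 4 - 1) ≤ 1 := by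
        rw [div_le_one (Real.sqrt_pos.2 ht), Real.one_le_sqrt]
        linarith
      have h₅ := Real.half_le_arctan_four_sevenths_mul (by positivity) h₄
      rw [mul_one_div] at h₅
      rw [h₃]
      calc 1 / π * (1 / Real.sqrt ((s / K) ^ 4 - 1))
          = 2 / π * (1 / Real.sqrt ((s / K) ^ 4 - 1) / 2) := by ring
        _ ≤ _ := by gcongr
end

section
/- Let n ≥ 1 be an integer, let h : ℝ → ℝ be n-times continuously differentiable with support contained in a compact subset of (0,1), with ‖h‖²_{H^n(0,1)} = Σ_{k=0}^{n} ∫₀¹ |h^{(k)}(x)|² dx, and let T ≥ 1 be an integer. Then Σ_{j=T}^{∞} |∫₀¹ sin(jπx) h(x) dx|² ≤ T^{−(2n−1)} ‖h‖²_{H^n(0,1)}. -/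
open MeasureTheory Real

/-- Repeated integration by parts of a compactly supported function against a sine wave. -/
lemma exists_phase_pow_mul_integral_sin_mul (a : ℝ) (n : ℕ) (c : ℝ) (f : ℝ → ℝ)
    (hf : ContDiff ℝ n f) (hsupp : tsupport f ⊆ Set.Ioo 0 1) :
    ∃ d : ℝ, a ^ n * ∫ x in (0:ℝ)..1, sin (a * x + c) * f x =
      ∫ x in (0:ℝ)..1, sin (a * x + d) * iteratedDeriv n f x := by
  induction n generalizing c f with
  | zero => exact ⟨c, by simp⟩
  | succ n ih =>
    have hf1 : ContDiff ℝ (n + 1) f := by exact_mod_cast hf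
    obtain ⟨hdiff, -, hderiv⟩ := contDiff_succ_iff_deriv.1 hf1
    obtain ⟨d, hd⟩ := ih (c + π / 2) (deriv f) hderiv
      ((closure_minimal support_deriv_subset (isClosed_tsupport f)).trans hsupp)
    refine ⟨d, ?_⟩
    rw [iteratedDeriv_succ', ← hd, pow_succ, mul_assoc]
    congr 1
    have h0 : f 0 = 0 := image_eq_zero_of_notMem_tsupport fun h => lt_irrefl _ (hsupp h).1
    have h1 : f 1 = 0 := image_eq_zero_of_notMem_tsupport fun h => lt_irrefl _ (hsupp h).2
    have hcos (x : ℝ) : HasDerivAt (fun x => cos (a * x + c)) (-sin (a * x + c) * a) x := by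
      simpa using (((hasDerivAt_id x).const_mul a).add_const c).cos
    have hparts := intervalIntegral.integral_mul_deriv_eq_deriv_mul (a := 0) (b := 1)
      (fun x _ => hcos x) (fun x _ => (hdiff x).hasDerivAt)
      (Continuous.intervalIntegrable (by fun_prop) _ _)
      (hderiv.continuous.intervalIntegrable _ _)
    simp only [← add_assoc, sin_add_pi_div_two]
    rw [hparts, h0, h1, ← intervalIntegral.integral_const_mul]
    simp only [mul_zero, sub_zero, zero_sub, ← intervalIntegral.integral_neg]
    congr 1
    ext x
    ring

/-- The Cauchy–Schwarz inequality on the unit interval, against the constant function one. -/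
lemma sq_integral_le_integral_sq {g : ℝ → ℝ} (hg : Continuous g) :
    (∫ x in (0:ℝ)..1, g x) ^ 2 ≤ ∫ x in (0:ℝ)..1, g x ^ 2 := by
  set m := ∫ x in (0:ℝ)..1, g x with hm
  have hnonneg : 0 ≤ ∫ x in (0:ℝ)..1, (g x - m) ^ 2 :=
    intervalIntegral.integral_nonneg zero_le_one fun x _ => sq_nonneg _
  have hexpand : ∫ x in (0:ℝ)..1, (g x - m) ^ 2 = (∫ x in (0:ℝ)..1, g x ^ 2) - m ^ 2 := by
    have hpt : ∀ x, (g x - m) ^ 2 = g x ^ 2 - (2 * m * g x - m ^ 2) := fun x => by ring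
    simp only [hpt]
    rw [intervalIntegral.integral_sub, intervalIntegral.integral_sub,
      intervalIntegral.integral_const_mul, ← hm]
    · simp
      ring
    all_goals exact Continuous.intervalIntegrable (by fun_prop) _ _
  linarith

lemma sq_integral_sin_mul_le {f : ℝ → ℝ} (hf : Continuous f) (a d : ℝ) :
    (∫ x in (0:ℝ)..1, sin (a * x + d) * f x) ^ 2 ≤ ∫ x in (0:ℝ)..1, f x ^ 2 := by
  refine (sq_integral_le_integral_sq (by fun_prop)).trans
    (intervalIntegral.integral_mono_on zero_le_one
      (Continuous.intervalIntegrable (by fun_prop) _ _)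
      (Continuous.intervalIntegrable (by fun_prop) _ _) fun x _ => ?_)
  rw [mul_pow]
  exact mul_le_of_le_one_left (sq_nonneg _) (sin_sq_le_one _)

lemma sum_range_inv_add_sq_le {T : ℕ} (hT : 1 ≤ T) (N : ℕ) :
    ∑ j ∈ Finset.range N, 1 / ((j + T : ℕ) : ℝ) ^ 2 ≤ 2 / (T : ℝ) := by
  have hT' : (1:ℝ) ≤ T := by exact_mod_cast hT
  suffices h : ∑ j ∈ Finset.range N, 1 / ((j + T : ℕ) : ℝ) ^ 2 ≤
      2 / (T : ℝ) - 2 / ((N + T : ℕ) : ℝ) from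
    h.trans (sub_le_self _ (by positivity))
  induction N with
  | zero => simp
  | succ N ih =>
    rw [Finset.sum_range_succ]
    have hstep : 1 / ((N + T : ℕ) : ℝ) ^ 2 ≤
        2 / ((N + T : ℕ) : ℝ) - 2 / ((N + 1 + T : ℕ) : ℝ) := by
      have hy : (1:ℝ) ≤ ((N + T : ℕ) : ℝ) := by exact_mod_cast hT.trans (Nat.le_add_left T N)
      have hsucc : ((N + 1 + T : ℕ) : ℝ) = ((N + T : ℕ) : ℝ) + 1 := by push_cast; ring
      rw [hsucc]
      generalize ((N + T : ℕ) : ℝ) = y at hy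
      rw [div_sub_div _ _ (by positivity) (by positivity),
        div_le_div_iff₀ (by positivity) (by positivity)]
      nlinarith
    linarith

/-- Lemma 4.3 of the paper: the tail `Σ_{j=T}^∞` of the squared sine-Fourier
coefficients of a compactly supported `Hⁿ` function decays like `T^{-(2n-1)}`. -/
theorem sine_coefficients_tail (n : ℕ) (hn : 1 ≤ n) (h : ℝ → ℝ)
    (hd : ContDiff ℝ n h) (hsupp : tsupport h ⊆ Set.Ioo 0 1)
    (T : ℕ) (hT : 1 ≤ T) :
    (∑' j : ℕ, (∫ x in (0:ℝ)..1, Real.sin (((j + T : ℕ) : ℝ) * π * x) * h x)^2) ≤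
      (T:ℝ)^(-(2*(n:ℝ)-1)) *
        ∑ k ∈ Finset.range (n+1), ∫ x in (0:ℝ)..1, |iteratedDeriv k h x|^2 := by
  obtain ⟨m, rfl⟩ : ∃ m, n = m + 1 := ⟨n - 1, by omega⟩
  have hT' : (1:ℝ) ≤ T := by exact_mod_cast hT
  set E : ℝ := ∫ x in (0:ℝ)..1, iteratedDeriv (m + 1) h x ^ 2
  have hE0 : 0 ≤ E := intervalIntegral.integral_nonneg zero_le_one fun x _ => sq_nonneg _
  have hE_le : E ≤ ∑ k ∈ Finset.range (m + 1 + 1),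
      ∫ x in (0:ℝ)..1, |iteratedDeriv k h x| ^ 2 := by
    simp only [sq_abs]
    exact Finset.single_le_sum (f := fun k => ∫ x in (0:ℝ)..1, iteratedDeriv k h x ^ 2)
      (fun k _ => intervalIntegral.integral_nonneg zero_le_one fun x _ => sq_nonneg _)
      (Finset.self_mem_range_succ _)
  have hpow : (T:ℝ) ^ (-(2 * ((m + 1 : ℕ) : ℝ) - 1)) = 1 / (T:ℝ) ^ (2 * m + 1) := by
    rw [rpow_neg (by positivity), one_div, ← rpow_natCast]
    congr 2
    push_cast
    ring
  have hcoeff (j : ℕ) : (∫ x in (0:ℝ)..1, sin (((j + T : ℕ) : ℝ) * π * x) * h x) ^ 2 ≤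
      E / (2 * (T:ℝ) ^ (2 * m)) * (1 / ((j + T : ℕ) : ℝ) ^ 2) := by
    have hTy : (T:ℝ) ≤ ((j + T : ℕ) : ℝ) := by exact_mod_cast Nat.le_add_left T j
    generalize ((j + T : ℕ) : ℝ) = y at hTy
    have hy : 0 < y := by linarith
    obtain ⟨d, hphase⟩ := exists_phase_pow_mul_integral_sin_mul (y * π) (m + 1) 0 h hd hsupp
    have hbound := sq_integral_sin_mul_le (hd.continuous_iteratedDeriv (m + 1) le_rfl) (y * π) d
    rw [← hphase] at hbound
    simp only [add_zero] at hbound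
    have hpi : (2:ℝ) ≤ π ^ (2 * (m + 1)) :=
      calc (2:ℝ) ≤ π := by linarith [pi_gt_three]
        _ ≤ π ^ (2 * (m + 1)) := le_self_pow₀ (by linarith [pi_gt_three]) (by omega)
    have hle : 2 * (T:ℝ) ^ (2 * m) * y ^ 2 ≤ ((y * π) ^ (m + 1)) ^ 2 := by
      have hTm : (T:ℝ) ^ (2 * m) ≤ y ^ (2 * m) := by gcongr
      calc 2 * (T:ℝ) ^ (2 * m) * y ^ 2 ≤ π ^ (2 * (m + 1)) * y ^ (2 * m) * y ^ 2 := by gcongr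
        _ = ((y * π) ^ (m + 1)) ^ 2 := by ring
    rw [div_mul_div_comm, mul_one, le_div_iff₀ (by positivity)]
    rw [mul_pow] at hbound
    nlinarith [mul_le_mul_of_nonneg_left hle
      (sq_nonneg (∫ x in (0:ℝ)..1, sin (y * π * x) * h x))]
  rw [hpow]
  refine le_trans ?_ (mul_le_mul_of_nonneg_left hE_le (by positivity))
  refine Real.tsum_le_of_sum_range_le (fun j => sq_nonneg _) fun N => ?_
  calc _ ≤ ∑ j ∈ Finset.range N, E / (2 * (T:ℝ) ^ (2 * m)) * (1 / ((j + T : ℕ) : ℝ) ^ 2) :=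
        Finset.sum_le_sum fun j _ => hcoeff j
    _ ≤ E / (2 * (T:ℝ) ^ (2 * m)) * (2 / T) := by
        rw [← Finset.mul_sum]
        exact mul_le_mul_of_nonneg_left (sum_range_inv_add_sq_le hT N) (by positivity)
    _ = 1 / (T:ℝ) ^ (2 * m + 1) * E := by
        field_simp
        ring
end

section
/- Let K > 1 and let ε ∈ (0, e^{−1}) satisfy 2^{1/4} (3π)^{1/3} K^{1/3} < |ln ε|^{1/4}. Set s = (3π)^{−1/3} K^{2/3} |ln ε|^{1/4}. Then s > 2^{1/4} K and 3s − (2 |ln ε| / π) (K/s)² ≤ −K^{2/3} |ln ε|^{1/2}. -/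
open Real

/-- The key elementary inequality in the proof of Theorem 2.1: with the
frequency cutoff `s = (3π)^{-1/3} K^{2/3} |ln ε|^{1/4}`, one has
`s > 2^{1/4} K` and `3s − (2|ln ε|/π)(K/s)² ≤ −K^{2/3}|ln ε|^{1/2}`. -/
theorem cutoff_inequality (K ε : ℝ) (hK : 1 < K)
    (hε0 : 0 < ε) (hε1 : ε < Real.exp (-1))
    (hKε : (2:ℝ)^((1:ℝ)/4) * (3*π)^((1:ℝ)/3) * K^((1:ℝ)/3) < |Real.log ε|^((1:ℝ)/4))
    (s : ℝ) (hs : s = (3*π)^(-(1:ℝ)/3) * K^((2:ℝ)/3) * |Real.log ε|^((1:ℝ)/4)) :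
    (2:ℝ)^((1:ℝ)/4) * K < s ∧
    3*s - (2 * |Real.log ε| / π) * (K/s)^2 ≤ -(K^((2:ℝ)/3) * |Real.log ε|^((1:ℝ)/2)) := by
  have hL : 1 < |Real.log ε| := by
    have h : Real.log ε < -1 := (Real.log_lt_iff_lt_exp hε0).2 hε1
    rw [abs_of_neg (by linarith)]
    linarith
  have hK0 : 0 < K := by linarith
  have hπ : 0 < 3 * π := by positivity
  generalize |Real.log ε| = L at *
  have hL0 : 0 < L := by linarith
  have ea : (3 * π) ^ (-(1:ℝ)/3) = ((3 * π) ^ ((1:ℝ)/3))⁻¹ := by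
    rw [← Real.rpow_neg hπ.le]
    norm_num
  have ea3 : ((3 * π) ^ ((1:ℝ)/3)) ^ 3 = 3 * π := by
    rw [← Real.rpow_mul_natCast hπ.le]
    norm_num
  have ek2 : K ^ ((2:ℝ)/3) = (K ^ ((1:ℝ)/3)) ^ 2 := by
    rw [← Real.rpow_mul_natCast hK0.le]
    norm_num
  have ek3 : (K ^ ((1:ℝ)/3)) ^ 3 = K := by
    rw [← Real.rpow_mul_natCast hK0.le]
    norm_num
  have el2 : L ^ ((1:ℝ)/2) = (L ^ ((1:ℝ)/4)) ^ 2 := by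
    rw [← Real.rpow_mul_natCast hL0.le]
    norm_num
  have el4 : (L ^ ((1:ℝ)/4)) ^ 4 = L := by
    rw [← Real.rpow_mul_natCast hL0.le]
    norm_num
  have ha0 : 0 < (3 * π) ^ ((1:ℝ)/3) := by positivity
  have hk0 : 0 < K ^ ((1:ℝ)/3) := by positivity
  have hl1 : 1 < L ^ ((1:ℝ)/4) := Real.one_lt_rpow hL (by norm_num)
  rw [ea, ek2] at hs
  rw [ek2, el2]
  generalize (3 * π) ^ ((1:ℝ)/3) = a at *
  generalize K ^ ((1:ℝ)/3) = k at *
  generalize L ^ ((1:ℝ)/4) = l at *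
  generalize (2:ℝ) ^ ((1:ℝ)/4) = b at *
  have hl0 : 0 < l := by linarith
  have ha3 : a ≤ 3 := by
    refine le_of_pow_le_pow_left₀ (n := 3) (by norm_num) (by norm_num) ?_
    linarith [Real.pi_le_four]
  have hπa : π = a ^ 3 / 3 := by linarith
  subst hs
  constructor
  · have h : b * K = a⁻¹ * k ^ 2 * (b * a * k) := by
      rw [← ek3]
      field_simp
    rw [h]
    gcongr
  · have h : 3 * (a⁻¹ * k ^ 2 * l) - (2 * L / π) * (K / (a⁻¹ * k ^ 2 * l)) ^ 2
        = -(3 / a * (k ^ 2 * (2 * l ^ 2 - l))) := by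
      rw [← ek3, ← el4, hπa]
      field_simp
      ring
    rw [h, neg_le_neg_iff]
    have hc : 1 ≤ 3 / a := (one_le_div ha0).2 ha3
    have hl : l ^ 2 ≤ 2 * l ^ 2 - l := by nlinarith
    calc k ^ 2 * l ^ 2 = 1 * (k ^ 2 * l ^ 2) := (one_mul _).symm
      _ ≤ 3 / a * (k ^ 2 * (2 * l ^ 2 - l)) := by gcongr
end
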